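/- The prop of commutative monoids CMon, freely generated by a multiplication μ: 2 → 1 and unit η: 0 → 1 subject to commutativity, associativity, and unitality, is isomorphic (as a symmetric strict monoidal category with objects the natural numbers) to the prop F whose morphisms m → n are functions {0,...,m-1} → {0,...,n-1} with monoidal product given by disjoint union. -/

import Mathlib

/- STATEMENT 0: The prop CMon of commutative monoids, freely generated by
μ: 2 → 1 and η: 0 → 1 subject to commutativity, associativity and unitality
(together with the laws of symmetric monoidal categories), is isomorphic, as a
prop (identity-on-objects, bijective on hom-sets, preserving identities,
composition, monoidal product and symmetries), to the prop F of functions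
between finite sets with monoidal product given by disjoint union. -/

/-- Σ-terms over the signature {μ : 2 → 1, η : 0 → 1}, built from identities,
symmetries, sequential and parallel composition (with explicit casts along
equalities of arities, needed to state the structural laws). -/
inductive CTerm : ℕ → ℕ → Type where
  | id (n : ℕ) : CTerm n n
  | swap (m n : ℕ) : CTerm (m + n) (n + m)
  | mu : CTerm 2 1
  | eta : CTerm 0 1
  | comp {m n k : ℕ} : CTerm m n → CTerm n k → CTerm m k
  | tensor {m n m' n' : ℕ} : CTerm m n → CTerm m' n' → CTerm (m + m') (n + n')
  | cast {m n m' n' : ℕ} : m = m' → n = n' → CTerm m n → CTerm m' n'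

/-- The smallest congruence containing the laws of symmetric monoidal
categories and the commutative monoid equations for (μ, η). -/
inductive CEq : {m n : ℕ} → CTerm m n → CTerm m n → Prop where
  | refl {m n} (t : CTerm m n) : CEq t t
  | symm {m n} {s t : CTerm m n} : CEq s t → CEq t s
  | trans {m n} {s t u : CTerm m n} : CEq s t → CEq t u → CEq s u
  | comp_congr {m n k} {s s' : CTerm m n} {t t' : CTerm n k} :
      CEq s s' → CEq t t' → CEq (s.comp t) (s'.comp t')
  | tensor_congr {m n m' n'} {s s' : CTerm m n} {t t' : CTerm m' n'} :
      CEq s s' → CEq t t' → CEq (s.tensor t) (s'.tensor t')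
  | cast_congr {m n m' n'} (h₁ : m = m') (h₂ : n = n') {s t : CTerm m n} :
      CEq s t → CEq (s.cast h₁ h₂) (t.cast h₁ h₂)
  | cast_rfl {m n} (t : CTerm m n) : CEq (t.cast rfl rfl) t
  -- category laws
  | assoc {m n k l} (s : CTerm m n) (t : CTerm n k) (u : CTerm k l) :
      CEq ((s.comp t).comp u) (s.comp (t.comp u))
  | id_left {m n} (t : CTerm m n) : CEq ((CTerm.id m).comp t) t
  | id_right {m n} (t : CTerm m n) : CEq (t.comp (CTerm.id n)) t
  -- monoidal laws
  | interchange {m n k m' n' k'} (s : CTerm m n) (s' : CTerm n k)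
      (t : CTerm m' n') (t' : CTerm n' k') :
      CEq ((s.tensor t).comp (s'.tensor t')) ((s.comp s').tensor (t.comp t'))
  | tensor_id (m n : ℕ) : CEq ((CTerm.id m).tensor (CTerm.id n)) (CTerm.id (m + n))
  | tensor_assoc {m n m' n' m'' n''} (s : CTerm m n) (t : CTerm m' n') (u : CTerm m'' n'') :
      CEq (((s.tensor t).tensor u).cast (Nat.add_assoc m m' m'') (Nat.add_assoc n n' n''))
        (s.tensor (t.tensor u))
  | unit_left {m n} (t : CTerm m n) :
      CEq (((CTerm.id 0).tensor t).cast (Nat.zero_add m) (Nat.zero_add n)) t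
  | unit_right {m n} (t : CTerm m n) : CEq (t.tensor (CTerm.id 0)) t
  -- symmetry laws
  | swap_swap (m n : ℕ) : CEq ((CTerm.swap m n).comp (CTerm.swap n m)) (CTerm.id (m + n))
  | swap_nat {m n} (s : CTerm m n) (k : ℕ) :
      CEq ((s.tensor (CTerm.id k)).comp (CTerm.swap n k))
        ((CTerm.swap m k).comp ((CTerm.id k).tensor s))
  | hexagon (m n o : ℕ) :
      CEq (CTerm.swap m (n + o))
        (((((CTerm.swap m n).tensor (CTerm.id o)).comp
            (((CTerm.id n).tensor (CTerm.swap m o)).cast (Nat.add_assoc n m o).symm rfl)).cast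
          (Nat.add_assoc m n o) (Nat.add_assoc n o m).symm))
  -- commutative monoid laws
  | mu_comm : CEq ((CTerm.swap 1 1).comp CTerm.mu) CTerm.mu
  | mu_assoc : CEq ((CTerm.mu.tensor (CTerm.id 1)).comp CTerm.mu)
      (((CTerm.id 1).tensor CTerm.mu).comp CTerm.mu)
  | mu_unit : CEq ((CTerm.eta.tensor (CTerm.id 1)).comp CTerm.mu) (CTerm.id 1)

/-- Disjoint union of functions between finite sets: the monoidal product
of the prop F. -/
def sumMap {m n m' n' : ℕ} (f : Fin m → Fin n) (g : Fin m' → Fin n') :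
    Fin (m + m') → Fin (n + n') :=
  fun x => finSumFinEquiv (Sum.map f g (finSumFinEquiv.symm x))

/-- The symmetry of the prop F. -/
def symFun (m n : ℕ) : Fin (m + n) → Fin (n + m) :=
  fun x => finSumFinEquiv (Sum.swap (finSumFinEquiv.symm x))

section

open CategoryTheory MonoidalCategory

/-- The objects of the syntactic category of `CMon`: natural numbers, wrapped to avoid the
category structure coming from the order. -/
structure CMonCat : Type where
  /-- The natural number `n` as an object of `CMonCat`. -/
  of ::
  /-- The underlying natural number. -/
  arity : ℕ

namespace CMonCat

instance : Category CMonCat where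
  Hom m n := Quot (@CEq m.arity n.arity)
  id n := Quot.mk _ (CTerm.id n.arity)
  comp {m n k} := Quot.map₂ (fun s t => s.comp t)
    (fun s _ _ h => .comp_congr (.refl s) h) (fun _ _ t h => .comp_congr h (.refl t))
  id_comp := by rintro m n ⟨t⟩; exact Quot.sound (.id_left t)
  comp_id := by rintro m n ⟨t⟩; exact Quot.sound (.id_right t)
  assoc := by rintro m n k l ⟨s⟩ ⟨t⟩ ⟨u⟩; exact Quot.sound (.assoc s t u)

/-- The morphism of `CMonCat` represented by a term. -/
def mk {m n : ℕ} (t : CTerm m n) : of m ⟶ of n := Quot.mk _ t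

lemma sound {m n : ℕ} {s t : CTerm m n} (h : CEq s t) : mk s = mk t := Quot.sound h

lemma mk_surjective {m n : ℕ} (f : of m ⟶ of n) : ∃ t : CTerm m n, mk t = f :=
  Quot.exists_rep f

lemma mk_id (n : ℕ) : mk (.id n) = 𝟙 (of n) := rfl

lemma mk_comp {m n k : ℕ} (s : CTerm m n) (t : CTerm n k) : mk (s.comp t) = mk s ≫ mk t := rfl

lemma mk_cast {m n m' n' : ℕ} (h₁ : m = m') (h₂ : n = n') (t : CTerm m n) :
    mk (t.cast h₁ h₂) = eqToHom (congrArg of h₁.symm) ≫ mk t ≫ eqToHom (congrArg of h₂) := by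
  subst h₁ h₂
  simpa using sound (.cast_rfl t)

instance : MonoidalCategoryStruct CMonCat where
  tensorObj m n := of (m.arity + n.arity)
  tensorUnit := of 0
  tensorHom := Quot.map₂ (fun s t => s.tensor t)
    (fun s _ _ h => .tensor_congr (.refl s) h) (fun _ _ t h => .tensor_congr h (.refl t))
  whiskerLeft m _ _ := Quot.map (fun t => (CTerm.id m.arity).tensor t)
    (fun _ _ h => .tensor_congr (.refl _) h)
  whiskerRight f n := Quot.map (fun t => t.tensor (CTerm.id n.arity))
    (fun _ _ h => .tensor_congr h (.refl _)) f
  associator m n k := eqToIso (congrArg of (Nat.add_assoc m.arity n.arity k.arity))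
  leftUnitor n := eqToIso (congrArg of (Nat.zero_add n.arity))
  rightUnitor _ := eqToIso rfl

lemma mk_tensor {m n m' n' : ℕ} (s : CTerm m n) (t : CTerm m' n') :
    mk (s.tensor t) = mk s ⊗ₘ mk t := rfl

lemma tensor_assoc (m n k : CMonCat) : (m ⊗ n) ⊗ k = m ⊗ n ⊗ k :=
  congrArg of (Nat.add_assoc m.arity n.arity k.arity)

lemma unit_tensor (n : CMonCat) : 𝟙_ CMonCat ⊗ n = n :=
  congrArg of (Nat.zero_add n.arity)

lemma tensor_unit (n : CMonCat) : n ⊗ 𝟙_ CMonCat = n := rfl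

lemma associator_hom (m n k : CMonCat) : (α_ m n k).hom = eqToHom (tensor_assoc m n k) := rfl

lemma leftUnitor_hom (n : CMonCat) : (λ_ n).hom = eqToHom (unit_tensor n) := rfl

lemma rightUnitor_hom (n : CMonCat) : (ρ_ n).hom = eqToHom (tensor_unit n) := rfl

lemma id_tensor_id (m n : CMonCat) : 𝟙 m ⊗ₘ 𝟙 n = 𝟙 (m ⊗ n) :=
  sound (.tensor_id m.arity n.arity)

lemma id_tensor_eqToHom {m m' n' : CMonCat} (h' : m' = n') :
    𝟙 m ⊗ₘ eqToHom h' = eqToHom (congrArg (m ⊗ ·) h') := by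
  subst h'
  exact id_tensor_id _ _

lemma eqToHom_tensor_id {m m' n' : CMonCat} (h' : m' = n') :
    eqToHom h' ⊗ₘ 𝟙 m = eqToHom (congrArg (· ⊗ m) h') := by
  subst h'
  exact id_tensor_id _ _

lemma tensorHom_assoc {m n k m' n' k' : CMonCat} (f : m ⟶ m') (g : n ⟶ n') (h : k ⟶ k') :
    f ⊗ₘ g ⊗ₘ h = eqToHom (tensor_assoc m n k).symm ≫ ((f ⊗ₘ g) ⊗ₘ h) ≫
      eqToHom (tensor_assoc m' n' k') := by
  obtain ⟨s, rfl⟩ := mk_surjective f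
  obtain ⟨t, rfl⟩ := mk_surjective g
  obtain ⟨u, rfl⟩ := mk_surjective h
  exact (sound (.tensor_assoc s t u)).symm.trans (mk_cast _ _ _)

lemma eq_id_tensorHom {m n : CMonCat} (f : m ⟶ n) :
    f = eqToHom (unit_tensor m).symm ≫ (𝟙 (𝟙_ CMonCat) ⊗ₘ f) ≫ eqToHom (unit_tensor n) := by
  obtain ⟨t, rfl⟩ := mk_surjective f
  exact (sound (.unit_left t)).symm.trans (mk_cast _ _ _)

lemma tensorHom_id_unit {m n : CMonCat} (f : m ⟶ n) : f ⊗ₘ 𝟙 (𝟙_ CMonCat) = f := by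
  obtain ⟨t, rfl⟩ := mk_surjective f
  exact sound (.unit_right t)

instance : MonoidalCategory CMonCat := .ofTensorHom
  (id_tensorHom_id := id_tensor_id)
  (id_tensorHom := by
    intro m n k f
    obtain ⟨t, rfl⟩ := mk_surjective f
    rfl)
  (tensorHom_id := by
    intro m n f k
    obtain ⟨t, rfl⟩ := mk_surjective f
    rfl)
  (tensorHom_comp_tensorHom := by
    intro m n k m' n' k' f f' g g'
    obtain ⟨s, rfl⟩ := mk_surjective f
    obtain ⟨t, rfl⟩ := mk_surjective f'
    obtain ⟨s', rfl⟩ := mk_surjective g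
    obtain ⟨t', rfl⟩ := mk_surjective g'
    exact sound (.interchange s s' t t'))
  (associator_naturality := by
    intro m n k m' n' k' f g h
    rw [tensorHom_assoc, associator_hom, associator_hom]
    simp)
  (leftUnitor_naturality := by
    intro m n f
    nth_rw 2 [eq_id_tensorHom f]
    rw [leftUnitor_hom, leftUnitor_hom, eqToHom_trans_assoc]
    simp)
  (rightUnitor_naturality := by
    intro m n f
    exact (Category.comp_id _).trans ((tensorHom_id_unit f).trans (Category.id_comp f).symm))
  (pentagon := by
    intro m n k l
    simp only [associator_hom, eqToHom_tensor_id, id_tensor_eqToHom, eqToHom_trans])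
  (triangle := by
    intro m n
    simp only [associator_hom, leftUnitor_hom, rightUnitor_hom, eqToHom_tensor_id,
      id_tensor_eqToHom, eqToHom_trans])

/-- The symmetry of `CMonCat`. -/
def swapIso (m n : CMonCat) : m ⊗ n ≅ n ⊗ m where
  hom := mk (.swap m.arity n.arity)
  inv := mk (.swap n.arity m.arity)
  hom_inv_id := sound (.swap_swap m.arity n.arity)
  inv_hom_id := sound (.swap_swap n.arity m.arity)

lemma swapIso_inv (m n : CMonCat) : (swapIso m n).inv = (swapIso n m).hom := rfl

lemma whiskerRight_swapIso {m n : CMonCat} (f : m ⟶ n) (k : CMonCat) :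
    f ▷ k ≫ (swapIso n k).hom = (swapIso m k).hom ≫ k ◁ f := by
  obtain ⟨t, rfl⟩ := mk_surjective f
  exact sound (.swap_nat t k.arity)

lemma swapIso_hexagon (m n k : CMonCat) :
    (swapIso m (n ⊗ k)).hom = (α_ m n k).inv ≫ (swapIso m n).hom ▷ k ≫ (α_ n m k).hom ≫
      n ◁ (swapIso m k).hom ≫ (α_ n k m).inv := by
  refine (sound (.hexagon m.arity n.arity k.arity)).trans ?_
  rw [mk_cast, mk_comp, mk_cast]
  simp only [Category.assoc, eqToHom_refl, Category.id_comp]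
  rfl

instance : SymmetricCategory CMonCat where
  braiding := swapIso
  braiding_naturality_left f k := whiskerRight_swapIso f k
  braiding_naturality_right m _ _ f := by
    rw [← Iso.eq_comp_inv, Category.assoc, swapIso_inv, whiskerRight_swapIso, ← swapIso_inv,
      Iso.inv_hom_id_assoc]
  hexagon_forward m n k := by
    rw [swapIso_hexagon]
    simp
  hexagon_reverse m n k := by
    have h : swapIso k (m ⊗ n) = (α_ k m n).symm ≪≫ whiskerRightIso (swapIso k m) n ≪≫
        α_ m k n ≪≫ whiskerLeftIso m (swapIso k n) ≪≫ (α_ m n k).symm :=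
      Iso.ext (swapIso_hexagon k m n)
    rw [← swapIso_inv, ← swapIso_inv, ← swapIso_inv, h]
    simp
  symmetry m n := (swapIso m n).hom_inv_id

open MonObj in
lemma tensor_unit_mul {C : Type*} [Category* C] [MonoidalCategory C] [BraidedCategory C]
    (X Y : C) [MonObj X] [MonObj Y] :
    ((ρ_ X).inv ≫ X ◁ η[Y] ⊗ₘ (λ_ Y).inv ≫ η[X] ▷ Y) ≫ μ[X ⊗ Y] = 𝟙 (X ⊗ Y) := by
  have h : ((ρ_ X).inv ⊗ₘ (λ_ Y).inv) ≫ tensorμ X (𝟙_ C) (𝟙_ C) Y =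
      (ρ_ X).inv ⊗ₘ (λ_ Y).inv := by
    simp only [tensorμ, braiding_tensorUnit_right]
    monoidal
  rw [tensorObj.mul_def, ← tensorHom_comp_tensorHom, ← id_tensorHom, ← tensorHom_id,
    Category.assoc, tensorμ_natural_assoc, reassoc_of% h]
  simp

/-- The object `1` of `CMonCat`, equipped with its tautological monoid structure. -/
def gen : CMonCat := of 1

/-- The multiplication of `gen`. -/
def mulGen : gen ⊗ gen ⟶ gen := mk .mu

/-- The unit of `gen`. -/
def oneGen : 𝟙_ CMonCat ⟶ gen := mk .eta

lemma braiding_mulGen : (β_ gen gen).hom ≫ mulGen = mulGen := sound .mu_comm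

lemma oneGen_mulGen : oneGen ▷ gen ≫ mulGen = (λ_ gen).hom := sound .mu_unit

instance : MonObj gen where
  one := oneGen
  mul := mulGen
  one_mul := oneGen_mulGen
  mul_one := by
    rw [← braiding_mulGen, BraidedCategory.braiding_naturality_right_assoc, oneGen_mulGen]
    simp
  mul_assoc :=
    (show mulGen ▷ gen ≫ mulGen = gen ◁ mulGen ≫ mulGen from sound .mu_assoc).trans
      (Category.id_comp _).symm

instance : IsCommMonObj gen where
  mul_comm := braiding_mulGen

instance monObj : ∀ n : ℕ, MonObj (of n)
  | 0 => inferInstanceAs (MonObj (𝟙_ CMonCat))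
  | n + 1 => letI := monObj n; inferInstanceAs (MonObj (of n ⊗ gen))

open MonObj in
instance isMonHom_one {C : Type*} [Category* C] [MonoidalCategory C] [BraidedCategory C]
    (X : C) [MonObj X] :
    IsMonHom η[X] where
  one_hom := by simp
  mul_hom := by
    rw [show μ[𝟙_ C] = (λ_ _).hom from rfl, tensorHom_def', Category.assoc, MonObj.one_mul]
    simp

open MonObj in
instance isMonHom_mul {C : Type*} [Category* C] [MonoidalCategory C] [BraidedCategory C]
    (X : C) [MonObj X] [IsCommMonObj X] : IsMonHom μ[X] where
  one_hom := by simp [tensorObj.one_def, ← unitors_equal]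
  mul_hom := by simp [tensorObj.mul_def, MonObj.mul_mul_mul_comm]

/-- The tensor product of `m` and `n` is `m + n`. -/
def tensorIso (m n : ℕ) : of m ⊗ of n ≅ of (m + n) := Iso.refl _

instance isMonHom_tensorIso (m : ℕ) : ∀ n : ℕ, IsMonHom (tensorIso m n).hom
  | 0 => inferInstanceAs (IsMonHom (ρ_ (of m)).hom)
  | n + 1 => by
    have := isMonHom_tensorIso m n
    have h : (tensorIso m (n + 1)).hom =
      (α_ (of m) (of n) gen).inv ≫ (tensorIso m n).hom ▷ gen := by
      change 𝟙 _ = 𝟙 _ ≫ 𝟙 _ ▷ gen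
      rw [id_whiskerRight, Category.id_comp]
    rw [h]
    exact inferInstanceAs
      (IsMonHom ((α_ (of m) (of n) gen).inv ≫ (tensorIso m n).hom ▷ gen))

instance : IsMonHom mulGen := inferInstanceAs (IsMonHom MonObj.mul)

instance : IsMonHom oneGen := inferInstanceAs (IsMonHom MonObj.one)

/-- The object `gen` is `1`. -/
def genIso : gen ≅ of 1 := Iso.refl _

instance : IsMonHom genIso.hom := inferInstanceAs (IsMonHom (λ_ gen).inv)

lemma isMonHom_mk {m n : ℕ} (t : CTerm m n) : IsMonHom (mk t) := by
  induction t with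
  | id n => exact inferInstanceAs (IsMonHom (𝟙 (of n)))
  | swap m n =>
    have h : mk (.swap m n) = (tensorIso m n).inv ≫ (β_ (of m) (of n)).hom ≫
      (tensorIso n m).hom :=
      ((Category.id_comp _).trans (Category.comp_id _)).symm
    rw [h]
    infer_instance
  | mu =>
    have h : mk .mu = (tensorIso 1 1).inv ≫ (genIso.inv ⊗ₘ genIso.inv) ≫ mulGen ≫
      genIso.hom := by
      change _ = 𝟙 _ ≫ (𝟙 _ ⊗ₘ 𝟙 _) ≫ mulGen ≫ 𝟙 _
      rw [id_tensor_id, Category.comp_id]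
      exact ((Category.id_comp _).trans (Category.id_comp _)).symm
    rw [h]
    infer_instance
  | eta =>
    have h : mk .eta = oneGen ≫ genIso.hom := (Category.comp_id _).symm
    rw [h]
    infer_instance
  | comp s t hs ht =>
    rw [mk_comp]
    infer_instance
  | @tensor m n m' n' s t hs ht =>
    have h : mk (s.tensor t) = (tensorIso m m').inv ≫ (mk s ⊗ₘ mk t) ≫ (tensorIso n n').hom :=
      ((Category.id_comp _).trans (Category.comp_id _)).symm
    rw [h]
    infer_instance
  | cast h₁ h₂ t ht =>
    subst h₁ h₂
    rwa [sound (.cast_rfl t)]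

open MonObj

lemma isMonHom {m n : ℕ} (f : of m ⟶ of n) : IsMonHom f := by
  obtain ⟨t, rfl⟩ := mk_surjective f
  exact isMonHom_mk t

lemma eq_of_comp_eq {C : Type*} [Category* C] [MonoidalCategory C] [BraidedCategory C]
    {X Y Z : C} [MonObj X] [MonObj Y] [MonObj Z] (f g : X ⊗ Y ⟶ Z) [IsMonHom f] [IsMonHom g]
    (hl : ((ρ_ X).inv ≫ X ◁ η[Y]) ≫ f = ((ρ_ X).inv ≫ X ◁ η[Y]) ≫ g)
    (hr : ((λ_ Y).inv ≫ η[X] ▷ Y) ≫ f = ((λ_ Y).inv ≫ η[X] ▷ Y) ≫ g) : f = g := by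
  rw [← Category.id_comp f, ← tensor_unit_mul, Category.assoc, IsMonHom.mul_hom,
    tensorHom_comp_tensorHom_assoc, hl, hr, ← tensorHom_comp_tensorHom_assoc, ← IsMonHom.mul_hom,
    ← Category.assoc, tensor_unit_mul, Category.id_comp]

/-- The left coproduct inclusion. -/
def inl (m n : ℕ) : of m ⟶ of (m + n) := (ρ_ (of m)).inv ≫ of m ◁ η[of n]

/-- The right coproduct inclusion. -/
def inr (m n : ℕ) : of n ⟶ of (m + n) := (λ_ (of n)).inv ≫ η[of m] ▷ of n

lemma hom_ext {m n k : ℕ} {f g : of (m + n) ⟶ of k} (hl : inl m n ≫ f = inl m n ≫ g)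
    (hr : inr m n ≫ f = inr m n ≫ g) : f = g := by
  have := isMonHom f
  have := isMonHom g
  have h (p : of (m + n) ⟶ of k) : (tensorIso m n).hom ≫ p = p := Category.id_comp p
  rw [← cancel_epi (tensorIso m n).hom]
  refine eq_of_comp_eq _ _ ?_ ?_
  · rw [h, h]
    exact hl
  · rw [h, h]
    exact hr

lemma hom_zero_ext {n : ℕ} (f g : of 0 ⟶ of n) : f = g := by
  have := isMonHom f
  have := isMonHom g
  have h := (IsMonHom.one_hom f).trans (IsMonHom.one_hom g).symm
  exact (Category.id_comp _).symm.trans (h.trans (Category.id_comp _))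

lemma inl_tensor {m n m' n' : ℕ} (s : CTerm m n) (t : CTerm m' n') :
    inl m m' ≫ mk (s.tensor t) = mk s ≫ inl n n' := by
  have := isMonHom (mk t)
  have h : ((ρ_ _).inv ≫ of m ◁ η[of m']) ≫ (mk s ⊗ₘ mk t) =
      mk s ≫ (ρ_ _).inv ≫ of n ◁ η[of n'] := by
    rw [tensorHom_def', Category.assoc, ← whiskerLeft_comp_assoc, IsMonHom.one_hom,
      whisker_exchange, rightUnitor_inv_naturality_assoc]
  exact h

lemma inr_tensor {m n m' n' : ℕ} (s : CTerm m n) (t : CTerm m' n') :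
    inr m m' ≫ mk (s.tensor t) = mk t ≫ inr n n' := by
  have := isMonHom (mk s)
  have h : ((λ_ _).inv ≫ η[of m] ▷ of m') ≫ (mk s ⊗ₘ mk t) =
      mk t ≫ (λ_ _).inv ≫ η[of n] ▷ of n' := by
    rw [MonoidalCategory.tensorHom_def, Category.assoc, ← comp_whiskerRight_assoc,
      IsMonHom.one_hom, ← whisker_exchange, leftUnitor_inv_naturality_assoc]
  exact h

lemma inl_swap (m n : ℕ) : inl m n ≫ mk (.swap m n) = inr n m := by
  have h : ((ρ_ _).inv ≫ of m ◁ η[of n]) ≫ (β_ (of m) (of n)).hom =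
      (λ_ _).inv ≫ η[of n] ▷ of m := by
    simp
  exact h

lemma inr_swap (m n : ℕ) : inr m n ≫ mk (.swap m n) = inl n m := by
  have h : ((λ_ _).inv ≫ η[of m] ▷ of n) ≫ (β_ (of m) (of n)).hom =
      (ρ_ _).inv ≫ of n ◁ η[of m] := by
    simp
  exact h

lemma inl_eq (m n : ℕ) : inl m n = of m ◁ η[of n] := Category.id_comp _

lemma inl_succ (m n : ℕ) : inl (m + n) 1 = of m ◁ inl n 1 := by
  rw [inl_eq, inl_eq]
  exact (tensor_whiskerLeft (of m) (of n) η[of 1]).trans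
    ((Category.id_comp _).trans (Category.comp_id _))

lemma inr_whiskerLeft (m : ℕ) {n k : ℕ} (f : of n ⟶ of k) :
    inr m n ≫ of m ◁ f = f ≫ inr m k := by
  have h : ((λ_ _).inv ≫ η[of m] ▷ of n) ≫ of m ◁ f = f ≫ (λ_ _).inv ≫ η[of m] ▷ of k := by
    rw [Category.assoc, ← whisker_exchange, leftUnitor_inv_naturality_assoc]
  exact h

lemma inl_inl (m n : ℕ) : inl m n ≫ inl (m + n) 1 = inl m (n + 1) := by
  rw [inl_succ, inl_eq, inl_eq m]
  exact (whiskerLeft_comp _ _ _).symm.trans (congrArg (of m ◁ ·) (hom_zero_ext _ _))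

lemma inr_inl (m n : ℕ) : inr m n ≫ inl (m + n) 1 = inl n 1 ≫ inr m (n + 1) := by
  rw [inl_succ]
  exact inr_whiskerLeft m (inl n 1)

lemma inr_one_eq (n : ℕ) : inr n 1 = η[of n] ▷ of 1 := Category.id_comp _

lemma inr_inr (m n : ℕ) : inr n 1 ≫ inr m (n + 1) = inr (m + n) 1 := by
  refine (inr_whiskerLeft m (inr n 1)).symm.trans ?_
  rw [inr_one_eq, inr_one_eq, inr_one_eq]
  have h : of m ◁ η[of n] ▷ of 1 = (of m ◁ η[of n]) ▷ of 1 :=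
    ((whisker_assoc (of m) η[of n] (of 1)).trans
      ((Category.id_comp _).trans (Category.comp_id _))).symm
  refine (congrArg (_ ≫ ·) h).trans ((comp_whiskerRight _ _ _).symm.trans ?_)
  exact congrArg (· ▷ of 1) (hom_zero_ext _ _)

lemma inl_mu : inl 1 1 ≫ mk .mu = 𝟙 (of 1) := by
  rw [inl_eq, hom_zero_ext η[of 1] oneGen]
  exact MonObj.mul_one gen

lemma inr_mu : inr 1 1 ≫ mk .mu = 𝟙 (of 1) := by
  rw [inr_one_eq, hom_zero_ext η[of 1] oneGen]
  exact MonObj.one_mul gen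

/-- The morphism `1 ⟶ n` selecting `i`. -/
def point : ∀ n : ℕ, Fin n → (of 1 ⟶ of n)
  | 0 => Fin.elim0
  | n + 1 => Fin.lastCases (inr n 1) fun i => point n i ≫ inl n 1

lemma point_castSucc {n : ℕ} (i : Fin n) : point (n + 1) i.castSucc = point n i ≫ inl n 1 := by
  simp [point]

lemma point_last (n : ℕ) : point (n + 1) (Fin.last n) = inr n 1 := by simp [point]

lemma point_castAdd {m : ℕ} (i : Fin m) (n : ℕ) :
    point (m + n) (Fin.castAdd n i) = point m i ≫ inl m n := by
  induction n with
  | zero =>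
    rw [inl_eq]
    exact ((congrArg (_ ≫ ·) (whiskerLeft_id _ _)).trans (Category.comp_id _)).symm
  | succ n ih => exact (point_castSucc _).trans (by rw [ih, Category.assoc, inl_inl])

lemma point_natAdd (m : ℕ) {n : ℕ} (i : Fin n) :
    point (m + n) (Fin.natAdd m i) = point n i ≫ inr m n := by
  induction n with
  | zero => exact i.elim0
  | succ n ih =>
    refine Fin.lastCases ?_ (fun i => ?_) i
    · rw [point_last]
      exact (point_last (m + n)).trans (inr_inr m n).symm
    · rw [point_castSucc]
      refine (point_castSucc (Fin.natAdd m i)).trans ?_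
      rw [ih, Category.assoc, Category.assoc, inr_inl]

lemma point_hom_ext {m n : ℕ} {f g : of m ⟶ of n}
    (h : ∀ i, point m i ≫ f = point m i ≫ g) : f = g := by
  induction m with
  | zero => exact hom_zero_ext f g
  | succ m ih =>
    refine hom_ext (ih fun i => ?_) ?_
    · simpa only [point_castSucc, Category.assoc] using h i.castSucc
    · simpa only [point_last] using h (Fin.last m)

end CMonCat

/-- The interpretation of a term as a function between finite sets. -/
def CTerm.eval : ∀ {m n : ℕ}, CTerm m n → Fin m → Fin n
  | _, _, .id _ => _root_.id
  | _, _, .swap m n => symFun m n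
  | _, _, .mu => fun _ => 0
  | _, _, .eta => Fin.elim0
  | _, _, .comp s t => t.eval ∘ s.eval
  | _, _, .tensor s t => sumMap s.eval t.eval
  | _, _, .cast h₁ h₂ t => Fin.cast h₂ ∘ t.eval ∘ Fin.cast h₁.symm

@[simp]
lemma sumMap_castAdd {m n m' n' : ℕ} (f : Fin m → Fin n) (g : Fin m' → Fin n') (i : Fin m) :
    sumMap f g (Fin.castAdd m' i) = Fin.castAdd n' (f i) := by simp [sumMap]

@[simp]
lemma sumMap_natAdd {m n m' n' : ℕ} (f : Fin m → Fin n) (g : Fin m' → Fin n') (i : Fin m') :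
    sumMap f g (Fin.natAdd m i) = Fin.natAdd n (g i) := by simp [sumMap]

@[simp]
lemma symFun_castAdd {m n : ℕ} (i : Fin m) : symFun m n (Fin.castAdd n i) = Fin.natAdd n i := by
  simp [symFun]

@[simp]
lemma symFun_natAdd {m n : ℕ} (i : Fin n) : symFun m n (Fin.natAdd m i) = Fin.castAdd m i := by
  simp [symFun]

lemma CEq.eval_eq {m n : ℕ} {s t : CTerm m n} (h : CEq s t) : s.eval = t.eval := by
  induction h with
  | refl => rfl
  | symm _ ih => exact ih.symm
  | trans _ _ ih ih' => exact ih.trans ih'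
  | comp_congr _ _ ih ih' => simp [CTerm.eval, ih, ih']
  | tensor_congr _ _ ih ih' => simp [CTerm.eval, ih, ih']
  | cast_congr _ _ _ ih => simp [CTerm.eval, ih]
  | cast_rfl => rfl
  | assoc => rfl
  | id_left => rfl
  | id_right => rfl
  | interchange s s' t t' =>
    ext i
    refine Fin.addCases (fun i => ?_) (fun i => ?_) i <;> simp [CTerm.eval]
  | tensor_id m n =>
    ext i
    refine Fin.addCases (fun i => ?_) (fun i => ?_) i <;> simp [CTerm.eval]
  | @tensor_assoc m n m' n' m'' n'' s t u =>
    funext i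
    refine Fin.addCases (fun i => ?_) (fun i => Fin.addCases (fun i => ?_) (fun i => ?_) i) i
    · have h : Fin.cast (Nat.add_assoc m m' m'').symm (Fin.castAdd (m' + m'') i) =
        Fin.castAdd m'' (Fin.castAdd m' i) := rfl
      simp [CTerm.eval, h, Fin.ext_iff]
    · have h : Fin.cast (Nat.add_assoc m m' m'').symm (Fin.natAdd m (Fin.castAdd m'' i)) =
        Fin.castAdd m'' (Fin.natAdd m i) := rfl
      simp [CTerm.eval, h, Fin.ext_iff]
    · have h : Fin.cast (Nat.add_assoc m m' m'').symm (Fin.natAdd m (Fin.natAdd m' i)) =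
        Fin.natAdd (m + m') i := Fin.ext (Nat.add_assoc m m' i).symm
      simp [CTerm.eval, h, Fin.ext_iff, Nat.add_assoc]
  | @unit_left m n t =>
    funext i
    have h : Fin.cast (Nat.zero_add m).symm i = Fin.natAdd 0 i := Fin.ext (Nat.zero_add i).symm
    exact (congrArg (Fin.cast (Nat.zero_add n))
      ((congrArg (sumMap _root_.id t.eval) h).trans (sumMap_natAdd _ _ i))).trans
      (Fin.ext (Nat.zero_add _))
  | unit_right t =>
    funext i
    exact sumMap_castAdd t.eval _root_.id i
  | swap_swap m n =>
    ext i
    refine Fin.addCases (fun i => ?_) (fun i => ?_) i <;> simp [CTerm.eval]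
  | swap_nat s k =>
    ext i
    refine Fin.addCases (fun i => ?_) (fun i => ?_) i <;> simp [CTerm.eval]
  | hexagon m n o =>
    funext i
    refine Fin.addCases (fun i => ?_) (fun i => Fin.addCases (fun i => ?_) (fun i => ?_) i) i
    · have h : Fin.cast (Nat.add_assoc m n o).symm (Fin.castAdd (n + o) i) =
        Fin.castAdd o (Fin.castAdd n i) := rfl
      have h' : Fin.cast (Nat.add_assoc n m o) (Fin.castAdd o (Fin.natAdd n i)) =
        Fin.natAdd n (Fin.castAdd o i) := rfl
      simp [CTerm.eval, h, h', Fin.ext_iff, Nat.add_assoc]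
    · have h : Fin.cast (Nat.add_assoc m n o).symm (Fin.natAdd m (Fin.castAdd o i)) =
        Fin.castAdd o (Fin.natAdd m i) := rfl
      have h' : Fin.cast (Nat.add_assoc n m o) (Fin.castAdd o (Fin.castAdd m i)) =
        Fin.castAdd (m + o) i := rfl
      simp [CTerm.eval, h, h', Fin.ext_iff]
    · have h : Fin.cast (Nat.add_assoc m n o).symm (Fin.natAdd m (Fin.natAdd n i)) =
        Fin.natAdd (m + n) i := Fin.ext (Nat.add_assoc m n i).symm
      have h' : Fin.cast (Nat.add_assoc n m o) (Fin.natAdd (n + m) i) =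
        Fin.natAdd n (Fin.natAdd m i) := Fin.ext (Nat.add_assoc n m i)
      simp [CTerm.eval, h, h', Fin.ext_iff]
  | mu_comm => rfl
  | mu_assoc => rfl
  | mu_unit => ext i; simp [CTerm.eval]

namespace CMonCat

open MonObj

lemma point_mk {m n : ℕ} (t : CTerm m n) (i : Fin m) : point m i ≫ mk t = point n (t.eval i) := by
  induction t with
  | id n => exact Category.comp_id _
  | swap m n =>
    refine Fin.addCases (fun i => ?_) (fun i => ?_) i
    · simp [CTerm.eval, point_castAdd, point_natAdd, inl_swap]
    · simp [CTerm.eval, point_castAdd, point_natAdd, inr_swap]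
  | mu =>
    have h : point 1 0 = 𝟙 (of 1) :=
      (point_last 0).trans ((inr_one_eq 0).trans (id_whiskerRight _ _))
    refine Fin.lastCases ?_ (fun i => ?_) i
    · rw [point_last, inr_mu]
      exact h.symm
    · rw [point_castSucc, Category.assoc, inl_mu, Category.comp_id]
      exact congrArg (point 1) (Subsingleton.elim _ _)
  | eta => exact i.elim0
  | comp s t hs ht => rw [mk_comp, ← Category.assoc, hs, ht]; rfl
  | tensor s t hs ht =>
    refine Fin.addCases (fun i => ?_) (fun i => ?_) i
    · simp [CTerm.eval, point_castAdd, inl_tensor, ← hs]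
    · simp [CTerm.eval, point_natAdd, inr_tensor, ← ht]
  | cast h₁ h₂ t ht =>
    subst h₁ h₂
    rw [sound (.cast_rfl t)]
    exact ht i

lemma eval_eq_of_mk_eq {m n : ℕ} {s t : CTerm m n} (h : mk s = mk t) : s.eval = t.eval :=
  congrArg (Quot.lift CTerm.eval fun _ _ h => h.eval_eq) h

lemma mk_eq_of_eval_eq {m n : ℕ} {s t : CTerm m n} (h : s.eval = t.eval) : mk s = mk t :=
  point_hom_ext fun i => by rw [point_mk, point_mk, h]

lemma exists_eval_fold (n : ℕ) : ∃ u : CTerm (n + n) n,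
    (∀ i, u.eval (Fin.castAdd n i) = i) ∧ ∀ i, u.eval (Fin.natAdd n i) = i := by
  obtain ⟨u, hu⟩ := mk_surjective (μ[of n] : of (n + n) ⟶ of n)
  obtain ⟨e, he⟩ := mk_surjective (η[of n] : of 0 ⟶ of n)
  refine ⟨u, fun i => ?_, fun i => ?_⟩
  · have h : mk (((CTerm.id n).tensor e).comp u) = mk (.id n) := by
      rw [mk_comp, mk_tensor, he, hu]
      exact (congrArg (· ≫ μ[of n]) (id_tensorHom _ _)).trans (MonObj.mul_one (of n))
    exact (congrArg u.eval (sumMap_castAdd _root_.id e.eval i)).symm.trans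
      (congrFun (eval_eq_of_mk_eq h) (Fin.castAdd 0 i))
  · have h : mk ((e.tensor (CTerm.id n)).comp u) =
        mk ((CTerm.id n).cast (Nat.zero_add n).symm rfl) := by
      rw [mk_comp, mk_tensor, he, hu, mk_cast, mk_id, eqToHom_refl, Category.comp_id,
        Category.comp_id]
      exact (congrArg (· ≫ μ[of n]) (tensorHom_id _ _)).trans (MonObj.one_mul (of n))
    exact (congrArg u.eval (sumMap_natAdd e.eval _root_.id i)).symm.trans
      ((congrFun (eval_eq_of_mk_eq h) (Fin.natAdd 0 i)).trans (Fin.ext (Nat.zero_add i)))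

lemma exists_eval_zero_eq {n : ℕ} (j : Fin n) : ∃ p : CTerm 1 n, p.eval 0 = j := by
  induction n with
  | zero => exact j.elim0
  | succ n ih =>
    refine Fin.lastCases ?_ (fun j => ?_) j
    · obtain ⟨e, -⟩ := mk_surjective (η[of n] : of 0 ⟶ of n)
      exact ⟨e.tensor (.id 1), sumMap_natAdd e.eval _root_.id 0⟩
    · obtain ⟨p, rfl⟩ := ih j
      exact ⟨p.tensor .eta, sumMap_castAdd p.eval Fin.elim0 0⟩

lemma eval_surjective {m n : ℕ} (f : Fin m → Fin n) : ∃ t : CTerm m n, t.eval = f := by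
  induction m with
  | zero =>
    obtain ⟨e, -⟩ := mk_surjective (η[of n] : of 0 ⟶ of n)
    exact ⟨e, Subsingleton.elim _ _⟩
  | succ m ih =>
    obtain ⟨t, ht⟩ := ih (f ∘ Fin.castSucc)
    obtain ⟨p, hp⟩ := exists_eval_zero_eq (f (Fin.last m))
    obtain ⟨u, hl, hr⟩ := exists_eval_fold n
    refine ⟨(t.tensor p).comp u, funext fun i => ?_⟩
    refine Fin.lastCases ?_ (fun i => ?_) i
    · exact (congrArg u.eval (sumMap_natAdd t.eval p.eval 0)).trans ((hr _).trans hp)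
    · exact (congrArg u.eval (sumMap_castAdd t.eval p.eval i)).trans
        ((hl _).trans (congrFun ht i))

end CMonCat

end

/-- CMon ≅ F: there is a family of bijections between the hom-sets of the
free prop CMon (Σ-terms modulo the congruence) and the hom-sets of F which is
identity-on-objects and preserves identities, composition, monoidal product,
symmetries, and sends μ and η to the codiagonal 2 → 1 and the empty function
0 → 1 respectively; i.e. an isomorphism of props. -/
theorem cmon_iso_finite_functions :
    ∃ e : ∀ m n : ℕ, Quot (@CEq m n) ≃ (Fin m → Fin n),
      (∀ n : ℕ, e n n (Quot.mk _ (CTerm.id n)) = id) ∧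
      (∀ (m n k : ℕ) (s : CTerm m n) (t : CTerm n k),
          e m k (Quot.mk _ (s.comp t)) = (e n k (Quot.mk _ t)) ∘ (e m n (Quot.mk _ s))) ∧
      (∀ (m n m' n' : ℕ) (s : CTerm m n) (t : CTerm m' n'),
          e (m + m') (n + n') (Quot.mk _ (s.tensor t))
            = sumMap (e m n (Quot.mk _ s)) (e m' n' (Quot.mk _ t))) ∧
      (∀ m n : ℕ, e (m + n) (n + m) (Quot.mk _ (CTerm.swap m n)) = symFun m n) ∧
      (e 2 1 (Quot.mk _ CTerm.mu) = fun _ => 0) ∧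
      (e 0 1 (Quot.mk _ CTerm.eta) = Fin.elim0) := by
  refine ⟨fun m n => Equiv.ofBijective (Quot.lift CTerm.eval fun _ _ h => h.eval_eq) ⟨?_, ?_⟩,
    fun _ => rfl, fun _ _ _ _ _ => rfl, fun _ _ _ _ _ _ => rfl, fun _ _ => rfl, rfl, rfl⟩
  · rintro ⟨s⟩ ⟨t⟩ h
    exact CMonCat.mk_eq_of_eval_eq h
  · intro f
    obtain ⟨t, rfl⟩ := CMonCat.eval_surjective f
    exact ⟨Quot.mk _ t, rfl⟩
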